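/- arXiv:1909.05648 — 3 statements merged into one kernel-verified Lean document; each statement's English description precedes it below -/
import Mathlib

section
/- If m is odd (so that m-1 is even), then α(m,n) ≥ α(1,n) · α(m-1,n) for every positive integer n. -/
open Finset

/-- A ±1 matrix: every entry is 1 or -1. -/
def IsPM {m n : ℕ} (M : Matrix (Fin m) (Fin n) ℤ) : Prop :=
  ∀ i j, M i j = 1 ∨ M i j = -1

/-- `goodA m n` is the set A(m,n) of m×n ±1 matrices all of whose row sums and
column sums have absolute value at most 1. -/
def goodA (m n : ℕ) : Set (Matrix (Fin m) (Fin n) ℤ) :=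
  {M | IsPM M ∧ (∀ i, |∑ j, M i j| ≤ 1) ∧ (∀ j, |∑ i, M i j| ≤ 1)}

/-- `alpha m n = |A(m,n)|`. -/
noncomputable def alpha (m n : ℕ) : ℕ := (goodA m n).ncard

lemma even_sum_of_isPM_column {k n : ℕ} {M : Matrix (Fin k) (Fin n) ℤ} (hM : IsPM M)
    (hk : Even k) (j : Fin n) : Even (∑ i, M i j) := by
  have h : Even (∑ i, (M i j - 1)) := by
    refine Finset.even_sum _ fun i _ => ?_
    rcases hM i j with h | h <;> rw [h] <;> decide
  rw [Finset.sum_sub_distrib] at h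
  have hk' : Even (∑ _i : Fin k, (1 : ℤ)) := by simpa using hk
  simpa using h.add hk'

lemma sum_column_eq_zero_of_mem_goodA {k n : ℕ} {M : Matrix (Fin k) (Fin n) ℤ}
    (hM : M ∈ goodA k n) (hk : Even k) (j : Fin n) : ∑ i, M i j = 0 := by
  obtain ⟨c, hc⟩ := even_sum_of_isPM_column hM.1 hk j
  have h := abs_le.mp (hM.2.2 j)
  omega

lemma finite_goodA (m n : ℕ) : (goodA m n).Finite := by
  have h : (Set.univ.pi fun _ : Fin m => Set.univ.pi fun _ : Fin n => ({1, -1} : Set ℤ)).Finite :=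
    Set.Finite.pi fun _ => Set.Finite.pi fun _ => Set.toFinite _
  exact h.subset fun M hM i _ j _ => hM.1 i j

lemma cons_mem_goodA {k n : ℕ} {R : Matrix (Fin 1) (Fin n) ℤ} {M : Matrix (Fin k) (Fin n) ℤ}
    (hR : R ∈ goodA 1 n) (hM : M ∈ goodA k n) (hk : Even k) :
    (Fin.cons (R 0) M : Fin (k + 1) → Fin n → ℤ) ∈ goodA (k + 1) n := by
  refine ⟨fun i j => ?_, fun i => ?_, fun j => ?_⟩
  · refine Fin.cases ?_ (fun i => ?_) i
    · exact hR.1 0 j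
    · exact hM.1 i j
  · refine Fin.cases ?_ (fun i => ?_) i
    · exact hR.2.1 0
    · exact hM.2.1 i
  · rw [Fin.sum_univ_succ]
    change |R 0 j + ∑ i, M i j| ≤ 1
    rw [sum_column_eq_zero_of_mem_goodA hM hk j, add_zero]
    simpa using hR.2.2 j

theorem stmt2 (m n : ℕ) (hm : Odd m) (hn : 0 < n) :
    alpha 1 n * alpha (m - 1) n ≤ alpha m n := by
  obtain ⟨k, rfl⟩ := hm
  rw [Nat.add_sub_cancel, alpha, alpha, alpha, ← Set.ncard_prod]
  refine Set.ncard_le_ncard_of_injOn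
    (fun p => (Fin.cons (p.1 0) p.2 : Fin (2 * k + 1) → Fin n → ℤ))
    (fun p hp => cons_mem_goodA hp.1 hp.2 (even_two_mul k)) ?_ (finite_goodA _ _)
  rintro ⟨R, M⟩ _ ⟨R', M'⟩ _ h
  obtain ⟨h₀, h₁⟩ := Fin.cons_injective2 h
  refine Prod.ext (funext fun i => ?_) h₁
  rw [Subsingleton.elim i 0]
  exact h₀
end

section
/- For every positive integer k, α(3,2k-1) - α(4,2k-1) = C(2k,k) · Σ_{i=0}^{k-1} C(k,i) · C(k-1,i) · C(2i,i+1), where C(a,b) denotes the binomial coefficient (with C(0,1)=0). -/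
open Finset

/-- For `#S = k`, the `k`-subsets `T` with `#(S \ T) = i` arise by exchanging an `i`-subset of `S`
for an `i`-subset of its complement. -/
lemma card_filter_powersetCard_card_sdiff {ι : Type*} [Fintype ι] [DecidableEq ι]
    (S : Finset ι) (i : ℕ) :
    #{T ∈ powersetCard #S (univ : Finset ι) | #(S \ T) = i} =
      (#S).choose i * (#Sᶜ).choose i := by
  rw [← card_powersetCard, ← card_powersetCard, ← card_product]
  refine card_nbij' (fun T => (S \ T, T \ S)) (fun p => (S \ p.1) ∪ p.2) ?_ ?_ ?_ ?_
  · intro T hT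
    simp only [coe_filter, mem_powersetCard, subset_univ, true_and, Set.mem_ofPred_eq] at hT
    simp only [coe_product, Set.mem_prod, mem_coe, mem_powersetCard, sdiff_subset, true_and]
    have := card_sdiff_comm hT.1
    refine ⟨hT.2, fun x hx => ?_, by omega⟩
    simp only [mem_sdiff, mem_compl] at hx ⊢
    exact hx.2
  · rintro ⟨A, B⟩ hp
    simp only [coe_product, Set.mem_prod, mem_coe, mem_powersetCard] at hp
    obtain ⟨⟨hA, rfl⟩, hB, hBA⟩ := hp
    have hBS : ∀ x ∈ B, x ∉ S := fun x hx => mem_compl.1 (hB hx)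
    simp only [coe_filter, mem_powersetCard, subset_univ, true_and, Set.mem_ofPred_eq]
    constructor
    · rw [card_union_of_disjoint, hBA, card_sdiff_of_subset hA]
      · have := card_le_card hA
        omega
      · rw [disjoint_left]
        intro x hx hx'
        exact hBS x hx' (mem_sdiff.1 hx).1
    · congr 1
      ext x
      have h1 := @hA x
      have h2 := hBS x
      simp only [mem_sdiff, mem_union]
      tauto
  · intro T _
    ext x
    simp only [mem_sdiff, mem_union]
    tauto
  · rintro ⟨A, B⟩ hp
    simp only [coe_product, Set.mem_prod, mem_coe, mem_powersetCard] at hp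
    obtain ⟨⟨hA, -⟩, hB, -⟩ := hp
    ext x
    · have h1 := @hA x
      have h2 := @hB x
      simp only [mem_sdiff, mem_union, mem_compl] at *
      tauto
    · have h1 := @hA x
      have h2 := @hB x
      simp only [mem_sdiff, mem_union, mem_compl] at *
      tauto

lemma card_filter_inter_empty_union_univ {ι : Type*} [Fintype ι] [DecidableEq ι]
    {k : ℕ} (hk : Fintype.card ι + 1 = 2 * k) {S T : Finset ι} (hS : #S = k) (hT : #T = k) :
    #{U ∈ powersetCard k (univ : Finset ι) | S ∩ T ∩ U = ∅ ∧ S ∪ T ∪ U = univ} =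
      (2 * #(S \ T)).choose (#(S \ T) + 1) := by
  have hTS : #(T \ S) = #(S \ T) := card_sdiff_comm (hT.trans hS.symm)
  have hdisj : Disjoint (S \ T) (T \ S) := disjoint_sdiff_sdiff
  have hD : #(S \ T ∪ T \ S) = 2 * #(S \ T) := by
    rw [card_union_of_disjoint hdisj]
    omega
  have hC : #(S ∪ T)ᶜ + #(S \ T) + 1 = k := by
    have h1 := card_compl_add_card (S ∪ T)
    have h2 := card_sdiff_add_card S T
    omega
  rw [← hD, ← card_powersetCard]
  refine card_nbij' (fun U => U ∩ (S \ T ∪ T \ S)) (fun V => (S ∪ T)ᶜ ∪ V) ?_ ?_ ?_ ?_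
  · intro U hU
    simp only [coe_filter, mem_powersetCard, subset_univ, true_and, Set.mem_ofPred_eq,
      Finset.ext_iff, mem_inter, mem_union, mem_univ, notMem_empty, iff_true, iff_false] at hU
    simp only [mem_coe, mem_powersetCard, inter_subset_right, true_and]
    have : U = (S ∪ T)ᶜ ∪ U ∩ (S \ T ∪ T \ S) := by
      ext x
      have h1 := hU.2.1 x
      have h2 := hU.2.2 x
      simp only [mem_union, mem_compl, mem_inter, mem_sdiff]
      tauto
    have h3 := congrArg card this
    rw [card_union_of_disjoint, hU.1] at h3
    · omega
    · rw [disjoint_left]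
      intro x
      simp only [mem_union, mem_compl, mem_inter, mem_sdiff]
      tauto
  · intro V hV
    simp only [mem_coe, mem_powersetCard] at hV
    simp only [coe_filter, mem_powersetCard, subset_univ, true_and, Set.mem_ofPred_eq]
    refine ⟨?_, ?_, ?_⟩
    · rw [card_union_of_disjoint]
      · omega
      · rw [disjoint_left]
        intro x hx hx'
        have := hV.1 hx'
        simp only [mem_union, mem_compl, mem_sdiff] at *
        tauto
    · ext x
      have := @hV.1 x
      simp only [mem_union, mem_compl, mem_sdiff, mem_inter, notMem_empty] at *
      tauto
    · ext x
      simp only [mem_union, mem_compl, mem_univ]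
      tauto
  · intro U hU
    simp only [coe_filter, Set.mem_ofPred_eq,
      Finset.ext_iff, mem_inter, mem_union, mem_univ, notMem_empty, iff_true, iff_false] at hU
    ext x
    have h1 := hU.2.1 x
    have h2 := hU.2.2 x
    simp only [mem_union, mem_compl, mem_inter, mem_sdiff]
    tauto
  · intro V hV
    simp only [mem_coe, mem_powersetCard] at hV
    ext x
    have := @hV.1 x
    simp only [mem_union, mem_compl, mem_inter, mem_sdiff] at *
    tauto

/-- Triples of `k`-subsets with empty common intersection and full union. -/
def coverTriples (ι : Type*) [Fintype ι] [DecidableEq ι] (k : ℕ) :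
    Finset (Finset ι × Finset ι × Finset ι) :=
  {p ∈ powersetCard k univ ×ˢ powersetCard k univ ×ˢ powersetCard k univ |
    p.1 ∩ p.2.1 ∩ p.2.2 = ∅ ∧ p.1 ∪ p.2.1 ∪ p.2.2 = univ}

lemma card_coverTriples {ι : Type*} [Fintype ι] [DecidableEq ι]
    {k : ℕ} (hk : Fintype.card ι + 1 = 2 * k) :
    #(coverTriples ι k) = (Fintype.card ι).choose k *
      ∑ i ∈ range k, k.choose i * (k - 1).choose i * (2 * i).choose (i + 1) := by
  simp only [coverTriples, card_filter, sum_product]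
  rw [← card_univ, ← card_powersetCard, ← smul_eq_mul, ← sum_const]
  refine sum_congr rfl fun S hS => ?_
  obtain ⟨-, hS⟩ := mem_powersetCard.1 hS
  have hSc : #Sᶜ = k - 1 := by
    rw [card_compl]
    omega
  calc _ = ∑ T ∈ powersetCard k (univ : Finset ι), (2 * #(S \ T)).choose (#(S \ T) + 1) := by
        refine sum_congr rfl fun T hT => ?_
        rw [← card_filter]
        exact card_filter_inter_empty_union_univ hk hS (mem_powersetCard.1 hT).2
    _ = ∑ i ∈ range (k + 1), ∑ T ∈ powersetCard k (univ : Finset ι) with #(S \ T) = i,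
          (2 * #(S \ T)).choose (#(S \ T) + 1) := by
        refine (sum_fiberwise_of_maps_to (fun T _ => ?_) _).symm
        have := card_le_card (sdiff_subset : S \ T ⊆ S)
        rw [mem_range]
        omega
    _ = ∑ i ∈ range (k + 1), k.choose i * (k - 1).choose i * (2 * i).choose (i + 1) := by
        refine sum_congr rfl fun i _ => ?_
        rw [sum_congr rfl (g := fun _ => (2 * i).choose (i + 1)), sum_const, smul_eq_mul]
        · have := card_filter_powersetCard_card_sdiff S i
          rw [hSc, hS] at this
          rw [this]
        · intro T hT
          rw [(mem_filter.1 hT).2]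
    _ = _ := by
        rw [sum_range_succ, Nat.choose_eq_zero_of_lt (by omega : k - 1 < k)]
        simp

/-- The ±1 vector with value `1` exactly on `S`. -/
def signVec {n : ℕ} (S : Finset (Fin n)) (j : Fin n) : ℤ := if j ∈ S then 1 else -1

lemma sum_signVec {n : ℕ} (S : Finset (Fin n)) : ∑ j, signVec S j = 2 * #S - n := by
  have h : ∀ j, signVec S j = 2 * (if j ∈ S then 1 else 0) - 1 := by
    intro j
    unfold signVec
    split_ifs <;> rfl
  simp [h, sum_sub_distrib, mul_comm]

lemma signVec_injective {n : ℕ} : Function.Injective (signVec (n := n)) := by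
  intro S T h
  ext j
  have := congrFun h j
  unfold signVec at this
  split_ifs at this <;> simp_all

lemma signVec_filter {n : ℕ} {v : Fin n → ℤ} (hv : ∀ j, v j = 1 ∨ v j = -1) :
    signVec {j | v j = 1} = v := by
  ext j
  rcases hv j with h | h <;> simp [signVec, h]

/-- The ±1 matrices with three rows, column sums at most `1` in absolute value and every row
sum equal to `c`. -/
def constRowSum (n : ℕ) (c : ℤ) : Set (Matrix (Fin 3) (Fin n) ℤ) :=
  {M | IsPM M ∧ (∀ i, ∑ j, M i j = c) ∧ ∀ j, |∑ i, M i j| ≤ 1}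

lemma constRowSum_one_eq_image {n k : ℕ} (hk : n + 1 = 2 * k) :
    constRowSum n 1 = (fun p : Finset (Fin n) × Finset (Fin n) × Finset (Fin n) =>
      Matrix.of ![signVec p.1, signVec p.2.1, signVec p.2.2]) ''
        coverTriples (Fin n) k := by
  have hcard (S : Finset (Fin n)) : ∑ j, signVec S j = 1 ↔ #S = k := by
    rw [sum_signVec]
    omega
  have hcol (S T U : Finset (Fin n)) : (∀ j, |signVec S j + signVec T j + signVec U j| ≤ 1) ↔
      S ∩ T ∩ U = ∅ ∧ S ∪ T ∪ U = univ := by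
    simp only [Finset.ext_iff, mem_inter, mem_union, mem_univ, notMem_empty, iff_true, iff_false,
      ← forall_and]
    refine forall_congr' fun j => ?_
    unfold signVec
    by_cases h1 : j ∈ S <;> by_cases h2 : j ∈ T <;> by_cases h3 : j ∈ U <;> simp [h1, h2, h3]
  ext M
  simp only [Set.mem_image, coverTriples, coe_filter, mem_product, mem_powersetCard, subset_univ,
    true_and, Set.mem_ofPred_eq, ← hcol, ← hcard, constRowSum, Prod.exists]
  constructor
  · rintro ⟨hM, hrow, hc⟩
    refine ⟨({j | M 0 j = 1} : Finset _), ({j | M 1 j = 1} : Finset _),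
      ({j | M 2 j = 1} : Finset _), ⟨⟨?_, ?_, ?_⟩, ?_⟩, ?_⟩
    · rw [signVec_filter (hM 0), hrow]
    · rw [signVec_filter (hM 1), hrow]
    · rw [signVec_filter (hM 2), hrow]
    · rw [signVec_filter (hM 0), signVec_filter (hM 1), signVec_filter (hM 2)]
      simpa only [Fin.sum_univ_three] using hc
    · ext i
      fin_cases i
      · exact congrFun (signVec_filter (hM 0)) _
      · exact congrFun (signVec_filter (hM 1)) _
      · exact congrFun (signVec_filter (hM 2)) _
  · rintro ⟨S, T, U, ⟨⟨hS, hT, hU⟩, hc⟩, rfl⟩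
    have hpm (S : Finset (Fin n)) (j : Fin n) : signVec S j = 1 ∨ signVec S j = -1 := by
      unfold signVec
      split_ifs <;> simp
    refine ⟨fun i j => ?_, fun i => ?_, fun j => ?_⟩
    · fin_cases i <;> exact hpm _ j
    · fin_cases i
      exacts [hS, hT, hU]
    · rw [Fin.sum_univ_three]
      exact hc j

lemma ncard_constRowSum_one {n k : ℕ} (hk : n + 1 = 2 * k) :
    (constRowSum n 1).ncard = n.choose k *
      ∑ i ∈ range k, k.choose i * (k - 1).choose i * (2 * i).choose (i + 1) := by
  rw [constRowSum_one_eq_image hk, Set.ncard_image_of_injective, Set.ncard_coe_finset,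
    card_coverTriples (by simpa using hk), Fintype.card_fin]
  rintro ⟨S, T, U⟩ ⟨S', T', U'⟩ h
  have h0 : signVec S = signVec S' := congrFun h 0
  have h1 : signVec T = signVec T' := congrFun h 1
  have h2 : signVec U = signVec U' := congrFun h 2
  rw [signVec_injective h0, signVec_injective h1, signVec_injective h2]

lemma IsPM.neg {m n : ℕ} {M : Matrix (Fin m) (Fin n) ℤ} (hM : IsPM M) : IsPM (-M) := by
  intro i j
  rcases hM i j with h | h <;> simp [h]

lemma neg_mem_constRowSum {n : ℕ} {c : ℤ} {M : Matrix (Fin 3) (Fin n) ℤ}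
    (hM : M ∈ constRowSum n c) : -M ∈ constRowSum n (-c) := by
  obtain ⟨h, hr, hc⟩ := hM
  refine ⟨h.neg, fun i => ?_, fun j => ?_⟩
  · simp [hr]
  · simpa [abs_neg, -neg_add_rev] using hc j

lemma ncard_constRowSum_neg (n : ℕ) (c : ℤ) :
    (constRowSum n (-c)).ncard = (constRowSum n c).ncard := by
  have : constRowSum n (-c) = Neg.neg '' constRowSum n c := by
    ext M
    constructor
    · intro h
      exact ⟨-M, by simpa using neg_mem_constRowSum h, neg_neg M⟩
    · rintro ⟨N, hN, rfl⟩
      exact neg_mem_constRowSum hN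
  rw [this, Set.ncard_image_of_injective _ neg_injective]

lemma odd_sum_of_pm {n : ℕ} (hn : Odd n) {v : Fin n → ℤ} (hv : ∀ j, v j = 1 ∨ v j = -1) :
    Odd (∑ j, v j) := by
  rw [← signVec_filter hv, sum_signVec]
  exact (even_two_mul _).sub_odd (by exact_mod_cast hn)

lemma Int.eq_one_or_neg_one_of_odd_of_abs_le_one {x : ℤ} (hx : Odd x) (h : |x| ≤ 1) :
    x = 1 ∨ x = -1 := by
  obtain ⟨y, rfl⟩ := hx
  rw [abs_le] at h
  omega

/-- Balanced columns of length four are determined by their first three entries. -/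
lemma alpha_four (n : ℕ) :
    alpha 4 n = {M ∈ goodA 3 n | |∑ i, ∑ j, M i j| ≤ 1}.ncard := by
  have hcol {M : Matrix (Fin 4) (Fin n) ℤ} (hM : M ∈ goodA 4 n) (j : Fin n) :
      M 3 j = -(M 0 j + M 1 j + M 2 j) := by
    have h := hM.2.2 j
    rw [Fin.sum_univ_four, abs_le] at h
    rcases hM.1 0 j with h0 | h0 <;> rcases hM.1 1 j with h1 | h1 <;>
      rcases hM.1 2 j with h2 | h2 <;> rcases hM.1 3 j with h3 | h3 <;> omega
  refine Set.ncard_congr (fun M _ => fun i j => M i.castSucc j) ?_ ?_ ?_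
  · intro M hM
    refine ⟨⟨fun i j => hM.1 _ j, fun i => hM.2.1 _, fun j => ?_⟩, ?_⟩
    · rw [Fin.sum_univ_three, abs_le]
      have := hcol hM j
      change _ ≤ M 0 j + M 1 j + M 2 j ∧ M 0 j + M 1 j + M 2 j ≤ _
      rcases hM.1 3 j with h | h <;> omega
    · have h := hM.2.1 3
      simp only [hcol hM, sum_neg_distrib, sum_add_distrib, abs_neg] at h
      rw [Fin.sum_univ_three]
      exact h
  · intro M N hM hN h
    have h' (i : Fin 3) (j : Fin n) : M i.castSucc j = N i.castSucc j := congrFun (congrFun h i) j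
    have h0 (j) : M 0 j = N 0 j := h' 0 j
    have h1 (j) : M 1 j = N 1 j := h' 1 j
    have h2 (j) : M 2 j = N 2 j := h' 2 j
    ext i j
    fin_cases i
    · exact h0 j
    · exact h1 j
    · exact h2 j
    · change M 3 j = N 3 j
      rw [hcol hM, hcol hN, h0, h1, h2]
  · rintro M ⟨⟨hM, hr, hc⟩, ht⟩
    refine ⟨Matrix.of ![M 0, M 1, M 2, fun j => -(M 0 j + M 1 j + M 2 j)], ⟨?_, ?_, ?_⟩, ?_⟩
    · intro i j
      fin_cases i
      · exact hM 0 j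
      · exact hM 1 j
      · exact hM 2 j
      · change -(M 0 j + M 1 j + M 2 j) = 1 ∨ -(M 0 j + M 1 j + M 2 j) = -1
        have h := hc j
        rw [Fin.sum_univ_three, abs_le] at h
        rcases hM 0 j with h0 | h0 <;> rcases hM 1 j with h1 | h1 <;>
          rcases hM 2 j with h2 | h2 <;> omega
    · intro i
      fin_cases i
      · exact hr 0
      · exact hr 1
      · exact hr 2
      · change |∑ j, -(M 0 j + M 1 j + M 2 j)| ≤ 1
        simpa only [sum_neg_distrib, sum_add_distrib, abs_neg, Fin.sum_univ_three] using ht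
    · intro j
      rw [Fin.sum_univ_four]
      change |M 0 j + M 1 j + M 2 j + -(M 0 j + M 1 j + M 2 j)| ≤ 1
      simp
    · ext i j
      fin_cases i <;> rfl

lemma goodA_three_diff {n : ℕ} (hn : Odd n) :
    goodA 3 n \ {M ∈ goodA 3 n | |∑ i, ∑ j, M i j| ≤ 1} =
      constRowSum n 1 ∪ constRowSum n (-1) := by
  ext M
  simp only [Set.mem_sdiff, Set.mem_ofPred_eq, not_and, Set.mem_union]
  constructor
  · rintro ⟨hM, h⟩
    have ht := h hM
    have hrow (i) : ∑ j, M i j = 1 ∨ ∑ j, M i j = -1 :=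
      Int.eq_one_or_neg_one_of_odd_of_abs_le_one (odd_sum_of_pm hn (hM.1 i)) (hM.2.1 i)
    rw [Fin.sum_univ_three, abs_le] at ht
    have hall : (∀ i, ∑ j, M i j = 1) ∨ ∀ i, ∑ j, M i j = -1 := by
      rcases hrow 0 with h0 | h0 <;> rcases hrow 1 with h1 | h1 <;>
        rcases hrow 2 with h2 | h2 <;> simp [Fin.forall_fin_succ, h0, h1, h2] at ht ⊢
    exact hall.imp (fun h => ⟨hM.1, h, hM.2.2⟩) fun h => ⟨hM.1, h, hM.2.2⟩
  · rintro (⟨hM, hr, hc⟩ | ⟨hM, hr, hc⟩)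
    · exact ⟨⟨hM, fun i => by simp [hr], hc⟩, fun _ => by simp [hr]⟩
    · exact ⟨⟨hM, fun i => by simp [hr], hc⟩, fun _ => by simp [hr]⟩

lemma alpha_three_eq {n : ℕ} (hn : Odd n) :
    alpha 3 n = alpha 4 n + 2 * (constRowSum n 1).ncard := by
  have hsub : {M ∈ goodA 3 n | |∑ i, ∑ j, M i j| ≤ 1} ⊆ goodA 3 n := Set.sep_subset _ _
  have hfin : (constRowSum n 1 ∪ constRowSum n (-1)).Finite := by
    rw [← goodA_three_diff hn]
    exact (finite_goodA 3 n).subset Set.sdiff_subset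
  have hdisj : Disjoint (constRowSum n 1) (constRowSum n (-1)) := by
    rw [Set.disjoint_left]
    intro M h h'
    have := (h.2.1 0).symm.trans (h'.2.1 0)
    omega
  have h := Set.ncard_sdiff_add_ncard_of_subset hsub (finite_goodA 3 n)
  rw [goodA_three_diff hn, Set.ncard_union_eq hdisj (hfin.subset Set.subset_union_left)
    (hfin.subset Set.subset_union_right), ncard_constRowSum_neg, ← alpha_four] at h
  rw [alpha, ← h]
  ring

theorem stmt10 (k : ℕ) (hk : 0 < k) :
    (alpha 3 (2 * k - 1) : ℤ) - (alpha 4 (2 * k - 1) : ℤ) =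
      (Nat.choose (2 * k) k : ℤ) *
        ∑ i ∈ Finset.range k,
          (Nat.choose k i : ℤ) * (Nat.choose (k - 1) i : ℤ) * (Nat.choose (2 * i) (i + 1) : ℤ) := by
  have hn : 2 * k - 1 + 1 = 2 * k := by omega
  have hchoose : 2 * (2 * k - 1).choose k = (2 * k).choose k := by
    obtain ⟨m, rfl⟩ : ∃ m, k = m + 1 := ⟨k - 1, by omega⟩
    rw [show 2 * (m + 1) - 1 = 2 * m + 1 by omega, show 2 * (m + 1) = 2 * m + 1 + 1 by ring,
      Nat.choose_succ_succ' (2 * m + 1) m, Nat.choose_symm_half]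
    ring
  rw [alpha_three_eq ⟨k - 1, by omega⟩, ncard_constRowSum_one hn, ← hchoose]
  push_cast
  ring
end

section
/- For every fixed positive integer m, lim_{n→∞} α(2m, 2n-1)/α(2m-1, 2n-1) = C(2m,m) / 2^{2m-1}, where C(a,b) denotes the binomial coefficient. -/
open Finset

/-- The number of walks of length `n` with steps `v i` that end at `x`. -/
def walkCount {ι G : Type*} [Fintype ι] [AddCommGroup G] [DecidableEq G]
    (v : ι → G) (n : ℕ) (x : G) : ℕ :=
  #{f : Fin n → ι | ∑ i, v (f i) = x}

/-- The set of end points of walks of length `n` with steps `v i`. -/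
def walkEnds {ι G : Type*} [Fintype ι] [AddCommGroup G] [DecidableEq G]
    (v : ι → G) (n : ℕ) : Finset G :=
  univ.image fun f : Fin n → ι => ∑ i, v (f i)

section Walks

variable {ι G : Type*} [Fintype ι] [AddCommGroup G] [DecidableEq G] {v : ι → G}

theorem walkCount_pos {n : ℕ} {x : G} :
    0 < walkCount v n x ↔ ∃ f : Fin n → ι, ∑ i, v (f i) = x := by
  simp [walkCount, Finset.card_pos, Finset.filter_nonempty_iff]

theorem walkCount_zero_zero : walkCount v 0 0 = 1 := by
  simp [walkCount]

theorem walkCount_add (a b : ℕ) (x : G) :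
    walkCount v (a + b) x = ∑ f : Fin a → ι, walkCount v b (x - ∑ i, v (f i)) := by
  classical
  simp only [walkCount, Finset.card_filter]
  rw [← (Fin.appendEquiv a b).sum_comp, Fintype.sum_prod_type]
  refine Finset.sum_congr rfl fun f _ => Finset.sum_congr rfl fun g _ => ?_
  simp [Fin.appendEquiv, Fin.sum_univ_add, eq_sub_iff_add_eq']

theorem walkCount_one_add (n : ℕ) (x : G) :
    walkCount v (1 + n) x = ∑ i, walkCount v n (x - v i) := by
  rw [walkCount_add, ← (Equiv.funUnique (Fin 1) ι).symm.sum_comp]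
  simp

theorem walkCount_add_eq_sum_walkEnds (a b : ℕ) (x : G) :
    walkCount v (a + b) x = ∑ y ∈ walkEnds v a, walkCount v a y * walkCount v b (x - y) := by
  rw [walkCount_add,
    Finset.sum_comp (fun y => walkCount v b (x - y)) (fun f : Fin a → ι => ∑ i, v (f i))]
  simp [walkCount, walkEnds]

theorem walkCount_eq_zero_of_notMem {n : ℕ} {y : G} (hy : y ∉ walkEnds v n) :
    walkCount v n y = 0 := by
  by_contra h
  obtain ⟨f, hf⟩ := walkCount_pos.1 (Nat.pos_of_ne_zero h)
  exact hy (by simpa [walkEnds] using ⟨f, hf⟩)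

theorem sum_mul_walkCount_le (a b : ℕ) (x : G) (T : Finset G) :
    ∑ y ∈ T, walkCount v a y * walkCount v b (x - y) ≤ walkCount v (a + b) x := by
  rw [walkCount_add_eq_sum_walkEnds]
  refine Finset.sum_le_sum_of_ne_zero fun y _ h => ?_
  by_contra hy
  exact h (by rw [walkCount_eq_zero_of_notMem hy, zero_mul])

theorem sum_walkEnds_walkCount (n : ℕ) :
    ∑ y ∈ walkEnds v n, walkCount v n y = Fintype.card ι ^ n := by
  classical
  have h := Finset.sum_comp (s := univ) (fun _ : G => 1) (fun f : Fin n → ι => ∑ i, v (f i))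
  simpa [walkCount, walkEnds] using h.symm

theorem card_walkEnds_le (n : ℕ) : #(walkEnds v n) ≤ (n + 1) ^ Fintype.card ι := by
  classical
  have hsub : walkEnds v n ⊆
      univ.image fun c : ι → Fin (n + 1) => ∑ i, (c i : ℕ) • v i := by
    intro y hy
    obtain ⟨f, -, rfl⟩ := Finset.mem_image.1 hy
    refine Finset.mem_image.2 ⟨fun i => ⟨#{j | f j = i}, ?_⟩, Finset.mem_univ _, ?_⟩
    · exact Nat.lt_succ_of_le ((Finset.card_le_univ _).trans (by simp))
    · rw [← Finset.sum_fiberwise univ f]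
      refine Finset.sum_congr rfl fun i _ => ?_
      rw [Finset.sum_congr rfl (g := fun _ => v i), Finset.sum_const]
      intro j hj
      rw [(Finset.mem_filter.1 hj).2]
  refine (Finset.card_le_card hsub).trans (Finset.card_image_le.trans ?_)
  simp

theorem walkCount_neg {σ : ι ≃ ι} (hσ : ∀ i, v (σ i) = -v i) (n : ℕ) (x : G) :
    walkCount v n (-x) = walkCount v n x := by
  refine Finset.card_equiv ((Equiv.refl (Fin n)).arrowCongr σ) ?_
  intro f
  simp [hσ, neg_eq_iff_eq_neg]

theorem walkCount_two_mul_zero {σ : ι ≃ ι} (hσ : ∀ i, v (σ i) = -v i) (n : ℕ) :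
    walkCount v (2 * n) 0 = ∑ y ∈ walkEnds v n, walkCount v n y ^ 2 := by
  rw [two_mul, walkCount_add_eq_sum_walkEnds]
  simp [walkCount_neg hσ, sq]

theorem sum_walkCount_sq_le {σ : ι ≃ ι} (hσ : ∀ i, v (σ i) = -v i) (n : ℕ) (T : Finset G) :
    ∑ y ∈ T, walkCount v n y ^ 2 ≤ walkCount v (2 * n) 0 := by
  simpa [walkCount_neg hσ, sq, two_mul] using sum_mul_walkCount_le (v := v) n n 0 T

theorem walkCount_two_mul_le {σ : ι ≃ ι} (hσ : ∀ i, v (σ i) = -v i) (n : ℕ) (x : G) :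
    walkCount v (2 * n) x ≤ walkCount v (2 * n) 0 := by
  have h1 := sum_walkCount_sq_le hσ n (walkEnds v n)
  have h2 := sum_walkCount_sq_le hσ n ((walkEnds v n).image fun y => x - y)
  rw [Finset.sum_image (by simp)] at h2
  have h3 : 2 * walkCount v (2 * n) x ≤ ∑ y ∈ walkEnds v n, walkCount v n y ^ 2
      + ∑ y ∈ walkEnds v n, walkCount v n (x - y) ^ 2 := by
    rw [two_mul n, walkCount_add_eq_sum_walkEnds, Finset.mul_sum, ← Finset.sum_add_distrib]
    refine Finset.sum_le_sum fun y _ => ?_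
    rw [← mul_assoc]
    exact two_mul_le_add_sq _ _
  omega

theorem walkCount_two_mul_zero_pos [Nonempty ι] {σ : ι ≃ ι} (hσ : ∀ i, v (σ i) = -v i)
    (n : ℕ) : 0 < walkCount v (2 * n) 0 := by
  obtain ⟨i⟩ := ‹Nonempty ι›
  have h : 0 < walkCount v n (n • v i) := walkCount_pos.2 ⟨fun _ => i, by simp⟩
  have := sum_walkCount_sq_le hσ n {n • v i}
  rw [Finset.sum_singleton] at this
  exact (pow_pos h 2).trans_le this

theorem walkCount_two_mul_zero_sq_le {σ : ι ≃ ι} (hσ : ∀ i, v (σ i) = -v i) (n : ℕ) :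
    walkCount v (2 * (n + 1)) 0 ^ 2 ≤
      walkCount v (2 * n) 0 * walkCount v (2 * (n + 2)) 0 := by
  have h : walkCount v (2 * (n + 1)) 0 =
      ∑ y ∈ walkEnds v n, walkCount v n y * walkCount v (n + 2) y := by
    rw [show 2 * (n + 1) = n + (n + 2) by ring, walkCount_add_eq_sum_walkEnds]
    simp [walkCount_neg hσ]
  rw [h, walkCount_two_mul_zero hσ n]
  exact (Finset.sum_mul_sq_le_sq_mul_sq _ _ _).trans
    (Nat.mul_le_mul_left _ (sum_walkCount_sq_le hσ (n + 2) _))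

theorem walkCount_two_mul_succ_le {σ : ι ≃ ι} (hσ : ∀ i, v (σ i) = -v i) (n : ℕ) :
    walkCount v (2 * (n + 1)) 0 ≤ Fintype.card ι ^ 2 * walkCount v (2 * n) 0 := by
  classical
  rw [show 2 * (n + 1) = 2 + 2 * n by ring, walkCount_add]
  refine (Finset.sum_le_card_nsmul _ _ _ fun f _ => walkCount_two_mul_le hσ n _).trans ?_
  simp

theorem card_pow_le_mul_walkCount {σ : ι ≃ ι} (hσ : ∀ i, v (σ i) = -v i) (n : ℕ) :
    (Fintype.card ι ^ 2) ^ n ≤ (n + 1) ^ Fintype.card ι * walkCount v (2 * n) 0 := by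
  rw [walkCount_two_mul_zero hσ, ← pow_mul, mul_comm 2 n, pow_mul,
    ← sum_walkEnds_walkCount (v := v)]
  exact sq_sum_le_card_mul_sum_sq.trans (Nat.mul_le_mul_right _ (card_walkEnds_le n))

theorem tendsto_ratio_of_log_convex {b : ℕ → ℝ} {c : ℝ} {D : ℕ} (hc : 0 < c)
    (hb : ∀ n, 0 < b n) (hconv : ∀ n, b (n + 1) ^ 2 ≤ b n * b (n + 2))
    (hle : ∀ n, b (n + 1) ≤ c * b n) (hlow : ∀ n : ℕ, c ^ n ≤ ((n : ℝ) + 1) ^ D * b n) :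
    Filter.Tendsto (fun n => b (n + 1) / b n) Filter.atTop (nhds c) := by
  have hmono : Monotone fun n => b (n + 1) / b n := by
    refine monotone_nat_of_le_succ fun n => ?_
    rw [div_le_div_iff₀ (hb _) (hb _)]
    nlinarith [hconv n]
  have hbdd : ∀ n, b (n + 1) / b n ≤ c := fun n => (div_le_iff₀ (hb n)).2 (hle n)
  refine tendsto_atTop_isLUB hmono ⟨by rintro _ ⟨n, rfl⟩; exact hbdd n, fun l hl => ?_⟩
  by_contra! hlc
  have hl' : ∀ n, b (n + 1) ≤ l * b n := fun n => (div_le_iff₀ (hb n)).1 (hl ⟨n, rfl⟩)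
  have hl0 : 0 < l := (div_pos (hb 1) (hb 0)).trans_le (hl ⟨0, rfl⟩)
  have hpow : ∀ n, b n ≤ l ^ n * b 0 := by
    intro n
    induction n with
    | zero => simp
    | succ n ih =>
      calc b (n + 1) ≤ l * b n := hl' n
        _ ≤ l * (l ^ n * b 0) := by gcongr
        _ = l ^ (n + 1) * b 0 := by ring
  have hlim := tendsto_pow_const_mul_const_pow_of_lt_one D (div_pos hl0 hc).le
    ((div_lt_one hc).2 hlc)
  have hlim' := (((Filter.tendsto_add_atTop_iff_nat 1).2 hlim).mul_const (c / l * b 0))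
  rw [zero_mul] at hlim'
  refine absurd (ge_of_tendsto' hlim' (b := 1) fun n => ?_) (by norm_num)
  have h := (hlow n).trans (mul_le_mul_of_nonneg_left (hpow n) (by positivity))
  have hcn := pow_pos hc n
  calc (1 : ℝ) ≤ ((n : ℝ) + 1) ^ D * (l ^ n * b 0) / c ^ n := by rwa [le_div_iff₀ hcn, one_mul]
    _ = _ := by push_cast; rw [div_pow]; field_simp; ring

theorem tendsto_walkCount_zero_ratio [Nonempty ι] {σ : ι ≃ ι} (hσ : ∀ i, v (σ i) = -v i)
    (j : ℕ) :
    Filter.Tendsto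
      (fun n => (walkCount v (2 * (n + j)) 0 : ℝ) / (walkCount v (2 * n) 0 : ℝ))
      Filter.atTop (nhds (((Fintype.card ι : ℝ) ^ 2) ^ j)) := by
  have hpos : ∀ n, (0 : ℝ) < walkCount v (2 * n) 0 := fun n =>
    Nat.cast_pos.2 (walkCount_two_mul_zero_pos hσ n)
  have h1 := tendsto_ratio_of_log_convex (b := fun n => (walkCount v (2 * n) 0 : ℝ))
    (c := (Fintype.card ι : ℝ) ^ 2) (D := Fintype.card ι)
    (by have := Fintype.card_pos (α := ι); positivity) hpos
    (fun n => by exact_mod_cast walkCount_two_mul_zero_sq_le hσ n)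
    (fun n => by exact_mod_cast walkCount_two_mul_succ_le hσ n)
    (fun n => by exact_mod_cast card_pow_le_mul_walkCount hσ n)
  induction j with
  | zero => simp [(hpos _).ne']
  | succ j ih =>
    rw [pow_succ']
    refine (((Filter.tendsto_add_atTop_iff_nat j).2 h1).mul ih).congr fun n => ?_
    have := (hpos (n + j)).ne'
    rw [div_mul_div_cancel₀ this, add_assoc]

theorem tendsto_walkCount_ratio [Nonempty ι] {σ : ι ≃ ι} (hσ : ∀ i, v (σ i) = -v i)
    {x : G} {j : ℕ} (hx : 0 < walkCount v (2 * j) x) :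
    Filter.Tendsto (fun n => (walkCount v (2 * n) x : ℝ) / (walkCount v (2 * n) 0 : ℝ))
      Filter.atTop (nhds 1) := by
  classical
  have hpos : ∀ n, (0 : ℝ) < walkCount v (2 * n) 0 := fun n =>
    Nat.cast_pos.2 (walkCount_two_mul_zero_pos hσ n)
  have hlow := (tendsto_walkCount_zero_ratio hσ j).sub_const
    (((Fintype.card ι : ℝ) ^ 2) ^ j - 1)
  rw [sub_sub_cancel] at hlow
  refine tendsto_of_tendsto_of_tendsto_of_le_of_le hlow tendsto_const_nhds (fun n => ?_)
    fun n => (div_le_one (hpos n)).2 (by exact_mod_cast walkCount_two_mul_le hσ n x)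
  obtain ⟨f, hf⟩ := walkCount_pos.1 hx
  have h : (walkCount v (2 * (n + j)) 0 : ℝ) ≤ walkCount v (2 * n) x +
      (((Fintype.card ι : ℝ) ^ 2) ^ j - 1) * walkCount v (2 * n) 0 := by
    rw [show 2 * (n + j) = 2 * j + 2 * n by ring, walkCount_add,
      ← Finset.add_sum_erase _ _ (Finset.mem_univ f), hf, zero_sub, walkCount_neg hσ]
    have := Finset.sum_le_card_nsmul (univ.erase f)
      (fun g => walkCount v (2 * n) (0 - ∑ i, v (g i))) _
      fun g _ => walkCount_two_mul_le hσ n _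
    have hcard : ((#(univ.erase f) : ℕ) : ℝ) = ((Fintype.card ι : ℝ) ^ 2) ^ j - 1 := by
      rw [Finset.card_erase_of_mem (Finset.mem_univ f), Nat.cast_pred
        (Finset.card_pos.2 ⟨f, Finset.mem_univ f⟩)]
      simp [pow_mul]
    rw [← hcard]
    push_cast
    gcongr
    exact_mod_cast this
  rw [sub_le_iff_le_add, div_add' _ _ _ (hpos n).ne', div_le_div_iff_of_pos_right (hpos n)]
  exact h

theorem walkCount_even_pos_of_mem_closure {x : G}
    (hx : x ∈ AddSubmonoid.closure {y | ∃ i j, y = v i + v j}) :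
    ∃ j, 0 < walkCount v (2 * j) x := by
  induction hx using AddSubmonoid.closure_induction with
  | mem y hy =>
    obtain ⟨i, j, rfl⟩ := hy
    exact ⟨1, walkCount_pos.2 ⟨![i, j], by simp [Fin.sum_univ_two]⟩⟩
  | zero => exact ⟨0, by simp [walkCount_zero_zero]⟩
  | add x y _ _ hx hy =>
    obtain ⟨a, ha⟩ := hx
    obtain ⟨b, hb⟩ := hy
    refine ⟨a + b, (Nat.mul_pos ha hb).trans_le ?_⟩
    simpa [mul_add] using sum_mul_walkCount_le (v := v) (2 * a) (2 * b) (x + y) {x}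

theorem tendsto_walkCount_odd_ratio [Nonempty ι] {σ : ι ≃ ι} (hσ : ∀ i, v (σ i) = -v i)
    {x : G} (hx : ∀ i, x - v i ∈ AddSubmonoid.closure {y | ∃ i j, y = v i + v j}) :
    Filter.Tendsto (fun n => (walkCount v (1 + 2 * n) x : ℝ) / (walkCount v (2 * n) 0 : ℝ))
      Filter.atTop (nhds (Fintype.card ι)) := by
  have h : Filter.Tendsto
      (fun n => ∑ i, (walkCount v (2 * n) (x - v i) : ℝ) / (walkCount v (2 * n) 0 : ℝ))
      Filter.atTop (nhds (∑ _i : ι, 1)) := tendsto_finsetSum _ fun i _ => by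
    obtain ⟨j, hj⟩ := walkCount_even_pos_of_mem_closure (hx i)
    exact tendsto_walkCount_ratio hσ hj
  simpa [walkCount_one_add, Finset.sum_div] using h

end Walks

/-- The vectors of length `d` with entries `1` and `-1`. -/
def signVectors (d : ℕ) : Finset (Fin d → ℤ) :=
  Fintype.piFinset fun _ => {1, -1}

/-- The vectors with entries `1` and `-1` whose sum has absolute value at most `1`. -/
def balancedVectors (d : ℕ) : Finset (Fin d → ℤ) :=
  {r ∈ signVectors d | |∑ i, r i| ≤ 1}

theorem mem_signVectors {d : ℕ} {r : Fin d → ℤ} :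
    r ∈ signVectors d ↔ ∀ i, r i = 1 ∨ r i = -1 := by
  simp [signVectors, Fintype.mem_piFinset]

theorem mem_balancedVectors {d : ℕ} {r : Fin d → ℤ} :
    r ∈ balancedVectors d ↔ (∀ i, r i = 1 ∨ r i = -1) ∧ |∑ i, r i| ≤ 1 := by
  simp [balancedVectors, mem_signVectors]

theorem card_signVectors (d : ℕ) : #(signVectors d) = 2 ^ d := by
  simp [signVectors]

/-- The vector that is `1` on `P` and `-1` elsewhere. -/
def signVector {d : ℕ} (P : Finset (Fin d)) (i : Fin d) : ℤ :=
  if i ∈ P then 1 else -1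

theorem signVector_mem {d : ℕ} (P : Finset (Fin d)) : signVector P ∈ signVectors d :=
  mem_signVectors.2 fun i => by unfold signVector; split_ifs <;> simp

theorem sum_signVector {d : ℕ} (P : Finset (Fin d)) :
    ∑ i, signVector P i = 2 * (#P : ℤ) - d := by
  have h : ∀ i, signVector P i = 2 * (if i ∈ P then 1 else 0) - 1 := fun i => by
    unfold signVector; split_ifs <;> norm_num
  simp [h, mul_comm]

theorem abs_sum_signVector_le_one_iff {k : ℕ} (P : Finset (Fin (2 * k + 1))) :
    |∑ i, signVector P i| ≤ 1 ↔ #P = k ∨ #P = k + 1 := by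
  rw [sum_signVector, abs_le]
  push_cast
  omega

theorem card_balancedVectors (k : ℕ) :
    #(balancedVectors (2 * k + 1)) = (2 * (k + 1)).choose (k + 1) := by
  have h : #(powersetCard k (univ : Finset (Fin (2 * k + 1))) ∪ powersetCard (k + 1) univ) =
      #(balancedVectors (2 * k + 1)) := by
    refine Finset.card_bij (fun P _ => signVector P) (fun P hP => ?_) (fun P _ Q _ h => ?_)
      fun r hr => ?_
    · refine Finset.mem_filter.2 ⟨signVector_mem P, (abs_sum_signVector_le_one_iff P).2 ?_⟩
      simpa using hP
    · ext i
      have := congrFun h i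
      unfold signVector at this
      split_ifs at this <;> simp_all
    · obtain ⟨h1, h2⟩ := mem_balancedVectors.1 hr
      have hr' : signVector {i | r i = 1} = r := by
        ext i
        rcases h1 i with h | h <;> simp [signVector, h]
      rw [← hr', abs_sum_signVector_le_one_iff] at h2
      exact ⟨_, by simpa using h2, hr'⟩
  rw [← h, Finset.card_union_of_disjoint, Finset.card_powersetCard, Finset.card_powersetCard,
    Finset.card_univ, Fintype.card_fin, show 2 * (k + 1) = 2 * k + 1 + 1 by ring,
    Nat.choose_succ_succ (2 * k + 1)]
  rw [Finset.disjoint_left]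
  intro P hP hQ
  rw [Finset.mem_powersetCard] at hP hQ
  omega

/-- The steps of the walk formed by the columns of a matrix in `goodA d n`. -/
def balancedStep (d : ℕ) (r : balancedVectors d) : Fin d → ℤ := r

theorem neg_mem_balancedVectors {d : ℕ} {r : Fin d → ℤ} (hr : r ∈ balancedVectors d) :
    -r ∈ balancedVectors d := by
  rw [mem_balancedVectors] at hr ⊢
  refine ⟨fun i => ?_, by simpa using hr.2⟩
  rcases hr.1 i with h | h <;> simp [h]

/-- Negation of balanced vectors. -/
def balancedNeg (d : ℕ) : balancedVectors d ≃ balancedVectors d where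
  toFun r := ⟨-r, neg_mem_balancedVectors r.2⟩
  invFun r := ⟨-r, neg_mem_balancedVectors r.2⟩
  left_inv r := by simp
  right_inv r := by simp

theorem sub_mem_closure_balancedStep {k : ℕ} {u w : Fin (2 * k + 1) → ℤ}
    (hu : u ∈ signVectors (2 * k + 1)) (hw : w ∈ signVectors (2 * k + 1)) :
    u - w ∈ AddSubmonoid.closure
      {y | ∃ i j, y = balancedStep (2 * k + 1) i + balancedStep (2 * k + 1) j} := by
  have key : ∀ i : Fin (2 * k + 1), ∃ r ∈ balancedVectors (2 * k + 1),
      ∃ s ∈ balancedVectors (2 * k + 1), Pi.single i 2 = r + s := by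
    intro i
    obtain ⟨P, hiP, -, hP⟩ := Finset.exists_subsuperset_card_eq (s := {i}) (t := univ)
      (n := k + 1) (by simp) (by simp) (by simp; omega)
    rw [Finset.singleton_subset_iff] at hiP
    refine ⟨signVector P, Finset.mem_filter.2 ⟨signVector_mem P,
        (abs_sum_signVector_le_one_iff P).2 (Or.inr hP)⟩,
      -signVector (P.erase i), neg_mem_balancedVectors (Finset.mem_filter.2 ⟨signVector_mem _,
        (abs_sum_signVector_le_one_iff _).2
          (Or.inl (by rw [Finset.card_erase_of_mem hiP, hP]; rfl))⟩), ?_⟩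
    ext j
    by_cases hj : j = i
    · subst hj
      simp [signVector, hiP]
    · simp [signVector, hj]
  rw [← Finset.univ_sum_single (u - w)]
  refine AddSubmonoid.sum_mem _ fun i _ => ?_
  obtain ⟨r, hr, s, hs, h⟩ := key i
  have hpos : Pi.single i 2 ∈ AddSubmonoid.closure
      {y | ∃ i j, y = balancedStep (2 * k + 1) i + balancedStep (2 * k + 1) j} :=
    AddSubmonoid.subset_closure ⟨⟨r, hr⟩, ⟨s, hs⟩, h⟩
  have hneg : Pi.single i (-2) ∈ AddSubmonoid.closure
      {y | ∃ i j, y = balancedStep (2 * k + 1) i + balancedStep (2 * k + 1) j} :=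
    AddSubmonoid.subset_closure ⟨⟨-r, neg_mem_balancedVectors hr⟩,
      ⟨-s, neg_mem_balancedVectors hs⟩, by
        rw [Pi.single_neg, h]; simp [balancedStep, add_comm]⟩
  rcases mem_signVectors.1 hu i with h1 | h1 <;> rcases mem_signVectors.1 hw i with h2 | h2 <;>
    simp only [Pi.sub_apply, h1, h2]
  · simp
  · exact hpos
  · exact hneg
  · simp

theorem sum_walkCount_eq_card {ι G : Type*} [Fintype ι] [AddCommGroup G] [DecidableEq G]
    (v : ι → G) (n : ℕ) (T : Finset G) :
    ∑ x ∈ T, walkCount v n x = #{f : Fin n → ι | ∑ j, v (f j) ∈ T} := by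
  rw [Finset.card_eq_sum_card_fiberwise (t := T) (f := fun f : Fin n → ι => ∑ j, v (f j))
    (by intro f hf; simpa using hf)]
  refine Finset.sum_congr rfl fun x hx => ?_
  rw [walkCount, Finset.filter_filter]
  congr 1
  ext f
  simp only [Finset.mem_filter, Finset.mem_univ, true_and]
  exact ⟨fun h => ⟨h ▸ hx, h⟩, fun h => h.2⟩

theorem sum_odd_of_sign {n : ℕ} (hn : Odd n) {a : Fin n → ℤ} (ha : ∀ i, a i = 1 ∨ a i = -1) :
    Odd (∑ i, a i) := by
  have h : ∀ i, (a i : ZMod 2) = 1 := fun i => by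
    rcases ha i with h | h <;> simp [h]
  rw [← Int.not_even_iff_odd, ← ZMod.intCast_eq_zero_iff_even]
  simpa [h, ZMod.natCast_eq_zero_iff_even] using hn

theorem abs_le_one_iff_of_odd {z : ℤ} (hz : Odd z) : |z| ≤ 1 ↔ z = 1 ∨ z = -1 := by
  obtain ⟨y, rfl⟩ := hz
  rw [abs_le]
  omega

theorem alpha_eq_sum_signVectors {d n : ℕ} (hn : Odd n) :
    alpha d n = ∑ u ∈ signVectors d, walkCount (balancedStep d) n u := by
  rw [sum_walkCount_eq_card, ← Set.ncard_coe_finset, alpha]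
  symm
  refine Set.ncard_congr (fun f _ => Matrix.of fun i j => balancedStep d (f j) i)
    (fun f hf => ?_) (fun f g _ _ h => ?_) fun M hM => ?_
  · have hf' : ∑ j, balancedStep d (f j) ∈ signVectors d := by simpa using hf
    rw [mem_signVectors] at hf'
    refine ⟨fun i j => (mem_balancedVectors.1 (f j).2).1 i, fun i => ?_,
      fun j => (mem_balancedVectors.1 (f j).2).2⟩
    have := hf' i
    rw [Finset.sum_apply] at this
    rcases this with h | h <;> simp [h]
  · ext j i
    exact congrFun (congrFun h i) j
  · obtain ⟨h1, h2, h3⟩ := hM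
    refine ⟨fun j => ⟨fun i => M i j, mem_balancedVectors.2 ⟨fun i => h1 i j, h3 j⟩⟩, ?_, rfl⟩
    suffices (∑ j, fun i => M i j) ∈ signVectors d from
      Finset.mem_coe.2 (Finset.mem_filter.2 ⟨Finset.mem_univ _, this⟩)
    refine mem_signVectors.2 fun i => ?_
    rw [Finset.sum_apply]
    exact (abs_le_one_iff_of_odd (sum_odd_of_sign hn (h1 i))).1 (h2 i)

theorem alpha_succ_eq_sum_balancedVectors {d n : ℕ} (hd : Odd d) (hn : Odd n) :
    alpha (d + 1) n = ∑ u ∈ balancedVectors d, walkCount (balancedStep d) n u := by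
  have hodd : ∀ r : balancedVectors d, Odd (∑ i, (r : Fin d → ℤ) i) := fun r =>
    sum_odd_of_sign hd (mem_balancedVectors.1 r.2).1
  rw [sum_walkCount_eq_card, ← Set.ncard_coe_finset, alpha]
  symm
  refine Set.ncard_congr
    (fun f _ => Matrix.of fun i j => (Fin.cons (-∑ i, balancedStep d (f j) i)
      (balancedStep d (f j)) : Fin (d + 1) → ℤ) i)
    (fun f hf => ?_) (fun f g _ _ h => ?_) fun M hM => ?_
  · have hf' : ∑ j, balancedStep d (f j) ∈ balancedVectors d := by simpa using hf
    rw [mem_balancedVectors] at hf'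
    refine ⟨fun i j => ?_, fun i => ?_, fun j => ?_⟩
    · refine Fin.cases ?_ (fun i => ?_) i
      · have := (abs_le_one_iff_of_odd (hodd (f j))).1 (mem_balancedVectors.1 (f j).2).2
        simp only [Matrix.of_apply, Fin.cons_zero, balancedStep]
        omega
      · exact (mem_balancedVectors.1 (f j).2).1 i
    · refine Fin.cases ?_ (fun i => ?_) i
      · have := hf'.2
        simp only [Finset.sum_apply] at this
        rw [Finset.sum_comm] at this
        simpa using this
      · have := hf'.1 i
        rw [Finset.sum_apply] at this
        rcases this with h | h <;> simp [h]
    · simp [Fin.sum_univ_succ]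
  · ext j i
    exact congrFun (congrFun h i.succ) j
  · obtain ⟨h1, h2, h3⟩ := hM
    have hsum : ∀ j, M 0 j + ∑ i : Fin d, M i.succ j = 0 := by
      intro j
      have hcol := h3 j
      have hs := sum_odd_of_sign hd fun i : Fin d => h1 i.succ j
      rw [Fin.sum_univ_succ, abs_le] at hcol
      obtain ⟨y, hy⟩ := hs
      rcases h1 0 j with h | h <;> omega
    have hbal : ∀ j, (fun i : Fin d => M i.succ j) ∈ balancedVectors d := fun j =>
      mem_balancedVectors.2 ⟨fun i => h1 i.succ j, by
        rw [← neg_eq_of_add_eq_zero_right (hsum j), abs_neg]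
        rcases h1 0 j with h | h <;> simp [h]⟩
    refine ⟨fun j => ⟨fun i => M i.succ j, hbal j⟩, ?_, ?_⟩
    · suffices (∑ j, fun i : Fin d => M i.succ j) ∈ balancedVectors d from
        Finset.mem_coe.2 (Finset.mem_filter.2 ⟨Finset.mem_univ _, this⟩)
      refine mem_balancedVectors.2 ⟨fun i => ?_, ?_⟩
      · rw [Finset.sum_apply]
        exact (abs_le_one_iff_of_odd (sum_odd_of_sign hn (h1 i.succ))).1 (h2 i.succ)
      · simp only [Finset.sum_apply]
        rw [Finset.sum_comm]
        rw [Finset.sum_congr rfl fun j _ => (neg_eq_of_add_eq_zero_right (hsum j)).symm,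
          Finset.sum_neg_distrib, abs_neg]
        exact h2 0
    · ext i j
      refine Fin.cases ?_ (fun i => ?_) i
      · simpa [balancedStep] using (eq_neg_of_add_eq_zero_left (hsum j)).symm
      · rfl

open Filter in
theorem stmt17 (m : ℕ) (hm : 0 < m) :
    Tendsto (fun n : ℕ => (alpha (2 * m) (2 * n - 1) : ℝ) / (alpha (2 * m - 1) (2 * n - 1) : ℝ))
      atTop (nhds ((Nat.choose (2 * m) m : ℝ) / 2 ^ (2 * m - 1))) := by
  obtain ⟨k, rfl⟩ : ∃ k, m = k + 1 := ⟨m - 1, by omega⟩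
  rw [← tendsto_add_atTop_iff_nat 1]
  have hd : 2 * (k + 1) - 1 = 2 * k + 1 := by omega
  have hn : ∀ n, 2 * (n + 1) - 1 = 1 + 2 * n := fun n => by omega
  simp only [hd, hn]
  set v := balancedStep (2 * k + 1)
  have hσ : ∀ r, v (balancedNeg (2 * k + 1) r) = -v r := fun r => rfl
  have hcard : Fintype.card (balancedVectors (2 * k + 1)) = (2 * (k + 1)).choose (k + 1) := by
    rw [Fintype.card_coe, card_balancedVectors]
  have hc : 0 < (2 * (k + 1)).choose (k + 1) := Nat.choose_pos (by omega)
  have : Nonempty (balancedVectors (2 * k + 1)) := Fintype.card_pos_iff.1 (hcard ▸ hc)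
  have hlim : ∀ T ⊆ signVectors (2 * k + 1), Tendsto
      (fun n => ((∑ u ∈ T, walkCount v (1 + 2 * n) u : ℕ) : ℝ) / (walkCount v (2 * n) 0 : ℝ))
      atTop (nhds (#T * ((2 * (k + 1)).choose (k + 1) : ℝ))) := fun T hT => by
    have := tendsto_finsetSum T fun u hu => tendsto_walkCount_odd_ratio hσ (x := u) fun r =>
      sub_mem_closure_balancedStep (hT hu) (Finset.mem_filter.1 r.2).1
    simpa [Finset.sum_div, card_balancedVectors] using this
  have hodd : ∀ n, Odd (1 + 2 * n) := fun n => ⟨n, by ring⟩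
  have h := (hlim (balancedVectors _) (Finset.filter_subset _ _)).div (hlim _ subset_rfl)
    (by rw [card_signVectors]; positivity)
  rw [card_signVectors, mul_div_mul_right _ _ (by positivity)] at h
  rw [card_balancedVectors, Nat.cast_pow, Nat.cast_ofNat] at h
  refine h.congr fun n => ?_
  have h0 : (walkCount v (2 * n) 0 : ℝ) ≠ 0 :=
    Nat.cast_ne_zero.2 (walkCount_two_mul_zero_pos hσ n).ne'
  rw [show 2 * (k + 1) = 2 * k + 1 + 1 by ring,
    alpha_succ_eq_sum_balancedVectors ⟨k, rfl⟩ (hodd n), alpha_eq_sum_signVectors (hodd n)]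
  exact div_div_div_cancel_right₀ h0 _ _
end
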